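/- arXiv:math/0012206 — 2 statements merged into one kernel-verified Lean document; each statement's English description precedes it below -/
import Mathlib

section
/- Let V be an n-dimensional complex vector space, let P ∈ Γ(V), let 0 ≤ m ≤ n, and let λ^m(P): Λ^m V → Λ^m V be obtained from any canonical basis pair for P. Then λ^m(P) ≠ 0 if and only if dim Indef P ≤ m ≤ dim Im P. -/
open Module

noncomputable section

variable {V W Y Z : Type*}
  [AddCommGroup V] [Module ℂ V] [AddCommGroup W] [Module ℂ W]
  [AddCommGroup Y] [Module ℂ Y] [AddCommGroup Z] [Module ℂ Z]

/-- The kernel of a linear relation `P : V ⇉ W`. -/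
def relKer (P : Submodule ℂ (V × W)) : Submodule ℂ V :=
  P.comap (LinearMap.inl ℂ V W)

/-- The indefiniteness of a linear relation `P : V ⇉ W`. -/
def relIndef (P : Submodule ℂ (V × W)) : Submodule ℂ W :=
  P.comap (LinearMap.inr ℂ V W)

/-- The domain of a linear relation `P : V ⇉ W`. -/
def relDom (P : Submodule ℂ (V × W)) : Submodule ℂ V :=
  P.map (LinearMap.fst ℂ V W)

/-- The image of a linear relation `P : V ⇉ W`. -/
def relIm (P : Submodule ℂ (V × W)) : Submodule ℂ W :=
  P.map (LinearMap.snd ℂ V W)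

/-- The product `QP` of two linear relations. -/
def relComp (Q : Submodule ℂ (W × Y)) (P : Submodule ℂ (V × W)) : Submodule ℂ (V × Y) where
  carrier := {p | ∃ w : W, (p.1, w) ∈ P ∧ (w, p.2) ∈ Q}
  add_mem' := by
    rintro ⟨a, b⟩ ⟨c, d⟩ ⟨w₁, h₁, h₂⟩ ⟨w₂, h₃, h₄⟩
    exact ⟨w₁ + w₂, P.add_mem h₁ h₃, Q.add_mem h₂ h₄⟩
  zero_mem' := ⟨0, P.zero_mem, Q.zero_mem⟩
  smul_mem' := by
    rintro c ⟨a, b⟩ ⟨w, h₁, h₂⟩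
    exact ⟨c • w, P.smul_mem c h₁, Q.smul_mem c h₂⟩

/-- The pair `(Q, P)` of linear relations is transversal. -/
def Transversal (Q : Submodule ℂ (W × Y)) (P : Submodule ℂ (V × W)) : Prop :=
  relIm P ⊔ relDom Q = ⊤ ∧ relIndef P ⊓ relKer Q = ⊥

end

noncomputable section

variable {V W : Type*} [AddCommGroup V] [Module ℂ V] [AddCommGroup W] [Module ℂ W]

/-- A canonical basis pair for a linear relation `S : V ⇉ W`: a basis
`f₁,…,f_α, g₁,…,g_β, h₁,…,h_γ` of `V` and a basis `F₁,…,F_μ, G₁,…,G_β, H₁,…,H_ν` of `W`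
such that `S` is spanned by the vectors `(0,Fᵢ)`, `(gⱼ,Gⱼ)`, `(hₗ,0)`. -/
structure CanonicalBasisPair (S : Submodule ℂ (V × W)) where
  α : ℕ
  β : ℕ
  γ : ℕ
  μ : ℕ
  ν : ℕ
  bV : Basis (Fin α ⊕ Fin β ⊕ Fin γ) ℂ V
  bW : Basis (Fin μ ⊕ Fin β ⊕ Fin ν) ℂ W
  hspan : S = Submodule.span ℂ
      (Set.range (fun i : Fin μ => ((0 : V), bW (Sum.inl i))) ∪
       Set.range (fun j : Fin β => (bV (Sum.inr (Sum.inl j)), bW (Sum.inr (Sum.inl j)))) ∪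
       Set.range (fun l : Fin γ => (bV (Sum.inr (Sum.inr l)), (0 : W))))

end

noncomputable section

variable {V W : Type*} [AddCommGroup V] [Module ℂ V] [AddCommGroup W] [Module ℂ W]

/-- The tuple `f₁, …, f_α, g_{i₁}, …, g_{i_s}` (with `i₁ < … < i_s` the elements of `s`)
in `V`, associated with a canonical basis pair. -/
def goodTupleV {S : Submodule ℂ (V × W)} (c : CanonicalBasisPair S)
    (s : Finset (Fin c.β)) : Fin (c.α + s.card) → V :=
  Fin.addCases (fun i => c.bV (Sum.inl i))
    (fun j => c.bV (Sum.inr (Sum.inl ((s.orderIsoOfFin rfl j : s) : Fin c.β))))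

/-- The tuple `F₁, …, F_μ, G_{i₁}, …, G_{i_s}` (with `i₁ < … < i_s` the elements of `s`)
in `W`, associated with a canonical basis pair. -/
def goodTupleW {S : Submodule ℂ (V × W)} (c : CanonicalBasisPair S)
    (s : Finset (Fin c.β)) : Fin (c.μ + s.card) → W :=
  Fin.addCases (fun i => c.bW (Sum.inl i))
    (fun j => c.bW (Sum.inr (Sum.inl ((s.orderIsoOfFin rfl j : s) : Fin c.β))))

/-- `L : Λ(V) → Λ(W)` is the operator `λ(S)` obtained from the canonical basis pair `c` for `S`:
it sends each basis monomial `f₁∧…∧f_α∧g_{i₁}∧…∧g_{i_s}` to `F₁∧…∧F_μ∧G_{i₁}∧…∧G_{i_s}` and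
every other monomial in the chosen basis of `V` (i.e. every monomial of basis vectors that
misses some `f` or contains some `h`) to `0`. -/
def IsLambda {S : Submodule ℂ (V × W)} (c : CanonicalBasisPair S)
    (L : ExteriorAlgebra ℂ V →ₗ[ℂ] ExteriorAlgebra ℂ W) : Prop :=
  (∀ s : Finset (Fin c.β),
      L (ExteriorAlgebra.ιMulti ℂ _ (goodTupleV c s)) =
        ExteriorAlgebra.ιMulti ℂ _ (goodTupleW c s)) ∧
  (∀ (k : ℕ) (x : Fin k → (Fin c.α ⊕ Fin c.β ⊕ Fin c.γ)),
      ((∃ i : Fin c.α, Sum.inl i ∉ Set.range x) ∨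
        (∃ l : Fin c.γ, Sum.inr (Sum.inr l) ∈ Set.range x)) →
      L (ExteriorAlgebra.ιMulti ℂ k (fun i => c.bV (x i))) = 0)

end

noncomputable section

variable {V W : Type*} [AddCommGroup V] [Module ℂ V] [AddCommGroup W] [Module ℂ W]

/-- The wedge product `x₁ ∧ … ∧ x_m` as an element of the `m`-th exterior power. -/
def ιMultiP (m : ℕ) (x : Fin m → V) : ⋀[ℂ]^m V :=
  ⟨ExteriorAlgebra.ιMulti ℂ m x, ExteriorAlgebra.ιMulti_range ℂ m (Set.mem_range_self x)⟩

/-- `L : Λ^m V → Λ^m W` is the degree-`m` component `λ^m(S)` of the operator obtained from the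
canonical basis pair `c` for `S`: it sends each degree-`m` basis monomial
`f₁∧…∧f_α∧g_{i₁}∧…∧g_{i_s}` to `F₁∧…∧F_μ∧G_{i₁}∧…∧G_{i_s}` and every other degree-`m`
monomial in the chosen basis of `V` to `0`. -/
def IsLambdaM {S : Submodule ℂ (V × W)} (c : CanonicalBasisPair S) (m : ℕ)
    (L : (⋀[ℂ]^m V) →ₗ[ℂ] (⋀[ℂ]^m W)) : Prop :=
  (∀ (s : Finset (Fin c.β)) (h1 : c.α + s.card = m) (h2 : c.μ + s.card = m),
      L (ιMultiP m (goodTupleV c s ∘ Fin.cast h1.symm)) =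
        ιMultiP m (goodTupleW c s ∘ Fin.cast h2.symm)) ∧
  (∀ x : Fin m → (Fin c.α ⊕ Fin c.β ⊕ Fin c.γ),
      ((∃ i : Fin c.α, Sum.inl i ∉ Set.range x) ∨
        (∃ l : Fin c.γ, Sum.inr (Sum.inr l) ∈ Set.range x)) →
      L (ιMultiP m fun i => c.bV (x i)) = 0)

end

noncomputable section

variable {V W : Type*} [AddCommGroup V] [Module ℂ V] [AddCommGroup W] [Module ℂ W]

lemma ιMultiP_eq_ιMulti (m : ℕ) (x : Fin m → V) : ιMultiP m x = exteriorPower.ιMulti ℂ m x :=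
  rfl

/-- The wedge product of distinct basis vectors is nonzero. -/
lemma ιMultiP_basis_ne_zero {I : Type*} (b : Basis I ℂ V) {m : ℕ} {x : Fin m → I}
    (hx : Function.Injective x) : ιMultiP m (fun i => b (x i)) ≠ 0 := by
  classical
  intro h
  have hdet : exteriorPower.pairingDual ℂ V m
      (exteriorPower.ιMulti ℂ m fun i => b.coord (x i))
      (exteriorPower.ιMulti ℂ m fun i => b (x i)) = 1 := by
    rw [exteriorPower.pairingDual_ιMulti_ιMulti, ← Matrix.det_one (n := Fin m)]
    congr 1
    ext i j
    simp [Matrix.one_apply, Finsupp.single_apply, hx.eq_iff]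
  rw [← ιMultiP_eq_ιMulti m (fun i => b (x i)), h, map_zero] at hdet
  exact zero_ne_one hdet

/-- A linear map on an exterior power that kills all wedge products of distinct basis vectors
vanishes. -/
lemma eq_zero_of_ιMultiP_basis {I N : Type*} [AddCommGroup N] [Module ℂ N] (b : Basis I ℂ V)
    {m : ℕ} {L : (⋀[ℂ]^m V) →ₗ[ℂ] N}
    (h : ∀ x : Fin m → I, Function.Injective x → L (ιMultiP m fun i => b (x i)) = 0) :
    L = 0 :=
  exteriorPower.linearMap_ext (b.ext_alternating fun x hx => h x hx)

namespace CanonicalBasisPair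

variable {S : Submodule ℂ (V × W)} (c : CanonicalBasisPair S)

lemma inl_mem (i : Fin c.μ) : ((0 : V), c.bW (Sum.inl i)) ∈ S := by
  exact c.hspan.ge (Submodule.subset_span (Or.inl (Or.inl ⟨i, rfl⟩)))

lemma inr_inl_mem (j : Fin c.β) :
    (c.bV (Sum.inr (Sum.inl j)), c.bW (Sum.inr (Sum.inl j))) ∈ S := by
  exact c.hspan.ge (Submodule.subset_span (Or.inl (Or.inr ⟨j, rfl⟩)))

lemma repr_eq_of_mem {p : V × W} (hp : p ∈ S) :
    (∀ j, c.bV.repr p.1 (Sum.inr (Sum.inl j)) = c.bW.repr p.2 (Sum.inr (Sum.inl j))) ∧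
      ∀ l, c.bW.repr p.2 (Sum.inr (Sum.inr l)) = 0 := by
  rw [c.hspan] at hp
  induction hp using Submodule.span_induction with
  | mem x hx =>
    rcases hx with (⟨i, rfl⟩ | ⟨j, rfl⟩) | ⟨l, rfl⟩ <;>
      simp [Finsupp.single_apply]
  | zero => simp
  | add x y _ _ hx hy => simp_all
  | smul a x _ hx => simp_all

/-- The index embedding of the vectors `F` and `G` into the basis of `W`. -/
def imIndex : Fin c.μ ⊕ Fin c.β → Fin c.μ ⊕ Fin c.β ⊕ Fin c.ν :=
  Sum.map id Sum.inl

lemma imIndex_injective : Function.Injective c.imIndex :=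
  Sum.map_injective.2 ⟨Function.injective_id, Sum.inl_injective⟩

lemma relIndef_eq_span :
    relIndef S = Submodule.span ℂ (Set.range (c.bW ∘ Sum.inl)) := by
  apply le_antisymm
  · intro w hw
    obtain ⟨hG, hH⟩ := c.repr_eq_of_mem (p := (0, w)) hw
    rw [← c.bW.sum_repr w, Fintype.sum_sum_type, Fintype.sum_sum_type]
    simp only [map_zero, Finsupp.coe_zero, Pi.zero_apply] at hG hH
    simp only [← hG, hH, zero_smul, Finset.sum_const_zero, add_zero]
    exact Submodule.sum_mem _ fun i _ =>
      Submodule.smul_mem _ _ (Submodule.subset_span ⟨i, rfl⟩)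
  · rw [Submodule.span_le]
    rintro _ ⟨i, rfl⟩
    exact c.inl_mem i

lemma relIm_eq_span :
    relIm S = Submodule.span ℂ (Set.range (c.bW ∘ c.imIndex)) := by
  apply le_antisymm
  · rintro w ⟨p, hp, rfl⟩
    obtain ⟨-, hH⟩ := c.repr_eq_of_mem hp
    rw [LinearMap.snd_apply, ← c.bW.sum_repr p.2, Fintype.sum_sum_type, Fintype.sum_sum_type]
    simp only [hH, zero_smul, Finset.sum_const_zero, add_zero]
    refine add_mem ?_ ?_ <;> refine Submodule.sum_mem _ fun i _ => Submodule.smul_mem _ _ ?_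
    · exact Submodule.subset_span ⟨Sum.inl i, rfl⟩
    · exact Submodule.subset_span ⟨Sum.inr i, rfl⟩
  · rw [Submodule.span_le]
    rintro _ ⟨i | j, rfl⟩
    · exact ⟨_, c.inl_mem i, rfl⟩
    · exact ⟨_, c.inr_inl_mem j, rfl⟩

lemma finrank_relIndef : finrank ℂ (relIndef S) = c.μ := by
  rw [c.relIndef_eq_span,
    finrank_span_eq_card (c.bW.linearIndependent.comp _ Sum.inl_injective), Fintype.card_fin]

lemma finrank_relIm : finrank ℂ (relIm S) = c.μ + c.β := by
  rw [c.relIm_eq_span,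
    finrank_span_eq_card (c.bW.linearIndependent.comp _ c.imIndex_injective)]
  simp

/-- The vectors `(0, Fᵢ)`, `(gⱼ, Gⱼ)`, `(hₗ, 0)` spanning the relation, as a single family. -/
def spanningFamily : Fin c.μ ⊕ Fin c.β ⊕ Fin c.γ → V × W :=
  Sum.elim (fun i => (0, c.bW (Sum.inl i)))
    (Sum.elim (fun j => (c.bV (Sum.inr (Sum.inl j)), c.bW (Sum.inr (Sum.inl j))))
      (fun l => (c.bV (Sum.inr (Sum.inr l)), 0)))

lemma linearIndependent_spanningFamily : LinearIndependent ℂ c.spanningFamily := by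
  rw [Fintype.linearIndependent_iff]
  intro a ha
  have hV := congrArg (fun p => c.bV.repr p.1) ha
  have hW := congrArg (fun p => c.bW.repr p.2) ha
  simp only [spanningFamily, Fintype.sum_sum_type, Sum.elim_inl, Sum.elim_inr, Prod.smul_mk,
    Prod.fst_add, Prod.snd_add, Prod.fst_sum, Prod.snd_sum, smul_zero, Finset.sum_const_zero,
    zero_add, add_zero, map_add, map_sum, map_smul, Basis.repr_self, Prod.fst_zero,
    Prod.snd_zero, map_zero] at hV hW
  rintro (i | j | l)
  · simpa [Finsupp.single_apply] using DFunLike.congr_fun hW (Sum.inl i)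
  · simpa [Finsupp.single_apply] using DFunLike.congr_fun hW (Sum.inr (Sum.inl j))
  · simpa [Finsupp.single_apply] using DFunLike.congr_fun hV (Sum.inr (Sum.inr l))

lemma finrank_eq : finrank ℂ S = c.μ + (c.β + c.γ) := by
  have hS : S = Submodule.span ℂ (Set.range c.spanningFamily) := by
    conv_lhs => rw [c.hspan]
    simp only [spanningFamily, Set.Sum.elim_range, Set.union_assoc]
  have h := finrank_span_eq_card c.linearIndependent_spanningFamily
  rw [← hS] at h
  simpa using h

lemma finrank_left : finrank ℂ V = c.α + (c.β + c.γ) := by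
  simpa using finrank_eq_card_basis c.bV

/-- The positions of `F₁, …, F_μ, G_{i₁}, …, G_{i_s}` in the basis of `W`. -/
def goodIndexW (s : Finset (Fin c.β)) :
    Fin (c.μ + s.card) → Fin c.μ ⊕ Fin c.β ⊕ Fin c.ν :=
  fun k => c.imIndex (Sum.map id (fun j => (s.orderIsoOfFin rfl j : Fin c.β))
    (finSumFinEquiv.symm k))

lemma goodIndexW_injective (s : Finset (Fin c.β)) : Function.Injective (c.goodIndexW s) :=
  c.imIndex_injective.comp ((Sum.map_injective.2 ⟨Function.injective_id,
    Subtype.val_injective.comp (s.orderIsoOfFin rfl).injective⟩).comp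
      finSumFinEquiv.symm.injective)

lemma goodTupleW_eq (s : Finset (Fin c.β)) (k : Fin (c.μ + s.card)) :
    goodTupleW c s k = c.bW (c.goodIndexW s k) := by
  induction k using Fin.addCases <;> simp [goodTupleW, goodIndexW, imIndex]

/-- A tuple of distinct basis vectors of `V` containing all `f` and no `h` has length between
`α` and `α + β`. -/
lemma le_and_le_of_injective {m : ℕ} {x : Fin m → Fin c.α ⊕ Fin c.β ⊕ Fin c.γ}
    (hx : Function.Injective x) (hf : ∀ i, Sum.inl i ∈ Set.range x)
    (hh : ∀ l, Sum.inr (Sum.inr l) ∉ Set.range x) : c.α ≤ m ∧ m ≤ c.α + c.β := by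
  constructor
  · choose y hy using hf
    have hyi : Function.Injective y := fun i j hij =>
      Sum.inl_injective ((hy i).symm.trans ((congrArg x hij).trans (hy j)))
    simpa using Fintype.card_le_of_injective y hyi
  · have hz : ∀ k, ∃ z : Fin c.α ⊕ Fin c.β, Sum.map id Sum.inl z = x k := by
      intro k
      rcases hk : x k with i | j | l
      · exact ⟨Sum.inl i, rfl⟩
      · exact ⟨Sum.inr j, rfl⟩
      · exact absurd ⟨k, hk⟩ (hh l)
    choose z hz using hz
    have hzi : Function.Injective z := fun i j hij =>
      hx ((hz i).symm.trans ((congrArg _ hij).trans (hz j)))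
    simpa using Fintype.card_le_of_injective z hzi

end CanonicalBasisPair

end

theorem lambdaM_ne_zero_iff
    {V : Type*} [AddCommGroup V] [Module ℂ V] [FiniteDimensional ℂ V]
    {n : ℕ} (hn : finrank ℂ V = n)
    (P : Submodule ℂ (V × V)) (hP : finrank ℂ P = n)
    (m : ℕ) (hm : m ≤ n)
    (c : CanonicalBasisPair P) (L : (⋀[ℂ]^m V) →ₗ[ℂ] (⋀[ℂ]^m V))
    (hL : IsLambdaM c m L) :
    L ≠ 0 ↔ (finrank ℂ (relIndef P) ≤ m ∧ m ≤ finrank ℂ (relIm P)) := by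
  rw [c.finrank_relIndef, c.finrank_relIm]
  have hαμ : c.α = c.μ := by
    have h₁ := c.finrank_left
    have h₂ := c.finrank_eq
    lia
  constructor
  · intro hL0
    by_contra hm'
    refine hL0 (eq_zero_of_ιMultiP_basis c.bV fun x hx => hL.2 x ?_)
    by_contra! hfh
    exact hm' (hαμ ▸ c.le_and_le_of_injective hx hfh.1 hfh.2)
  · rintro ⟨h₁, h₂⟩ rfl
    obtain ⟨s, -, hs⟩ := Finset.exists_subset_card_eq
      (s := (Finset.univ : Finset (Fin c.β))) (n := m - c.μ) (by simp; lia)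
    have hW : c.μ + s.card = m := by lia
    have h := hL.1 s (hαμ ▸ hW) hW
    rw [LinearMap.zero_apply] at h
    refine ιMultiP_basis_ne_zero c.bW
      ((c.goodIndexW_injective s).comp (Fin.cast_injective hW.symm)) ?_
    rw [h]
    congr 1
    exact funext fun k => (c.goodTupleW_eq s _).symm
end

section
/- Let (P_1,…,P_k) be a hinge on an n-dimensional complex vector space V and let α_j = rk P_j. Then (α_1,…,α_k) is a composition of n (each α_j ≥ 1 and α_1+…+α_k = n), and there exist g_1, g_2 ∈ GL(V) such that P_j = g_1 P_{α,j} g_2 for all j, where for a linear relation R and g_1, g_2 ∈ GL(V) one sets g_1 R g_2 := {(v, g_1 w) : (g_2 v, w) ∈ R}. Consequently, two hinges lie in the same orbit of the action of GL(V) × GL(V) if and only if they have the same number of terms and the same sequence of ranks, so the orbits of GL(V) × GL(V) on the set of hinges on V are in bijection with compositions of n. -/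
open Module

/-- `(P 0, …, P (k-1))` is a hinge on `V` (with `n = dim V`): each `P j` is a linear relation
`V ⇉ V` of dimension `n`, consecutive terms satisfy `Ker P_j = Dom P_{j+1}` and
`Im P_j = Indef P_{j+1}`, the first term satisfies `Dom P_1 = V`, the last term satisfies
`Im P_k = V`, and every term has positive rank. -/
structure IsHinge {V : Type*} [AddCommGroup V] [Module ℂ V]
    {k : ℕ} (P : Fin k → Submodule ℂ (V × V)) : Prop where
  pos : 0 < k
  dim_eq : ∀ j, Module.finrank ℂ (P j) = Module.finrank ℂ V
  ker_eq_dom : ∀ (j : ℕ) (h : j + 1 < k), relKer (P ⟨j, by omega⟩) = relDom (P ⟨j + 1, h⟩)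
  im_eq_indef : ∀ (j : ℕ) (h : j + 1 < k), relIm (P ⟨j, by omega⟩) = relIndef (P ⟨j + 1, h⟩)
  dom_first : relDom (P ⟨0, pos⟩) = ⊤
  im_last : relIm (P ⟨k - 1, by omega⟩) = ⊤
  rk_pos : ∀ j, Module.finrank ℂ (relKer (P j)) + Module.finrank ℂ (relIndef (P j)) <
    Module.finrank ℂ (P j)

noncomputable section

/-- The rank of a linear relation: `rk P = dim P − dim Ker P − dim Indef P`. -/
def relRk {V : Type*} [AddCommGroup V] [Module ℂ V] (P : Submodule ℂ (V × V)) : ℕ :=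
  Module.finrank ℂ P - Module.finrank ℂ (relKer P) - Module.finrank ℂ (relIndef P)

/-- The linear relation on `ℂⁿ` spanned by the vectors `(0, e_σ)` for `σ < a`,
`(e_τ, e_τ)` for `a ≤ τ < b`, and `(e_μ, 0)` for `b ≤ μ`. -/
def canonicalRel (n a b : ℕ) : Submodule ℂ ((Fin n → ℂ) × (Fin n → ℂ)) :=
  Submodule.span ℂ
    {p | ∃ σ : Fin n,
        (σ.1 < a ∧ p = (0, Pi.basisFun ℂ (Fin n) σ)) ∨
        (a ≤ σ.1 ∧ σ.1 < b ∧ p = (Pi.basisFun ℂ (Fin n) σ, Pi.basisFun ℂ (Fin n) σ)) ∨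
        (b ≤ σ.1 ∧ p = (Pi.basisFun ℂ (Fin n) σ, 0))}

/-- The partial sum `u_j = α_1 + … + α_{j-1}` of a composition. -/
def partialSum {k : ℕ} (α : Fin k → ℕ) (j : ℕ) : ℕ :=
  ∑ i ∈ Finset.univ.filter (fun i : Fin k => i.1 < j), α i

/-- The canonical hinge `P_α` on `ℂⁿ` associated with a composition `α` of `n`. -/
def canonicalHinge (n : ℕ) {k : ℕ} (α : Fin k → ℕ) :
    Fin k → Submodule ℂ ((Fin n → ℂ) × (Fin n → ℂ)) :=
  fun j => canonicalRel n (partialSum α j.1) (partialSum α (j.1 + 1))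

/-- The action of `(g₁, g₂) ∈ GL(V) × GL(V)` on linear relations:
`g₁ R g₂ = {(v, g₁ w) : (g₂ v, w) ∈ R}`. -/
def hingeAct {V : Type*} [AddCommGroup V] [Module ℂ V]
    (g₁ g₂ : V ≃ₗ[ℂ] V) (R : Submodule ℂ (V × V)) : Submodule ℂ (V × V) :=
  R.comap (LinearMap.prodMap (g₂ : V →ₗ[ℂ] V) (g₁.symm : V →ₗ[ℂ] V))

section Relations

variable {V : Type*} [AddCommGroup V] [Module ℂ V]

theorem finrank_map_of_injective {E F : Type*} [AddCommGroup E] [Module ℂ E] [AddCommGroup F]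
    [Module ℂ F] {f : E →ₗ[ℂ] F} (hf : Function.Injective f) (A : Submodule ℂ E) :
    finrank ℂ (A.map f) = finrank ℂ A :=
  (Submodule.equivMapOfInjective f hf A).finrank_eq.symm

theorem finrank_relDom_add_finrank_relIndef [FiniteDimensional ℂ V] (P : Submodule ℂ (V × V)) :
    finrank ℂ (relDom P) + finrank ℂ (relIndef P) = finrank ℂ P := by
  have hker : (relIndef P).map (LinearMap.inr ℂ V V) =
      (LinearMap.ker ((LinearMap.fst ℂ V V).domRestrict P)).map P.subtype := by
    ext ⟨a, b⟩
    simp only [relIndef, Submodule.mem_map, Submodule.mem_comap, LinearMap.inr_apply,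
      Prod.mk.injEq, LinearMap.mem_ker, Submodule.subtype_apply, Subtype.exists,
      LinearMap.domRestrict_apply, LinearMap.fst_apply]
    constructor
    · rintro ⟨w, hw, rfl, rfl⟩
      exact ⟨(0, w), hw, rfl, rfl⟩
    · rintro ⟨⟨x, w⟩, hw, rfl, h⟩
      simp only [Prod.mk.injEq] at h
      exact ⟨w, hw, h⟩
  have h := LinearMap.finrank_range_add_finrank_ker ((LinearMap.fst ℂ V V).domRestrict P)
  rw [LinearMap.range_domRestrict, ← Submodule.finrank_map_subtype_eq, ← hker,
    finrank_map_of_injective (f := LinearMap.inr ℂ V V) LinearMap.inr_injective] at h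
  exact h

theorem finrank_relIm_add_finrank_relKer [FiniteDimensional ℂ V] (P : Submodule ℂ (V × V)) :
    finrank ℂ (relIm P) + finrank ℂ (relKer P) = finrank ℂ P := by
  have h := finrank_relDom_add_finrank_relIndef
    (P.map (LinearEquiv.prodComm ℂ V V : V × V →ₗ[ℂ] V × V))
  rw [LinearEquiv.finrank_map_eq] at h
  have h₁ : relDom (P.map (LinearEquiv.prodComm ℂ V V : V × V →ₗ[ℂ] V × V)) = relIm P := by
    rw [relDom, relIm, ← Submodule.map_comp]
    rfl
  have h₂ : relIndef (P.map (LinearEquiv.prodComm ℂ V V : V × V →ₗ[ℂ] V × V)) = relKer P := by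
    ext v
    simp [relIndef, relKer]
  rwa [h₁, h₂] at h

theorem map_inl_sup_map_inr_le (P : Submodule ℂ (V × V)) :
    (relKer P).map (LinearMap.inl ℂ V V) ⊔ (relIndef P).map (LinearMap.inr ℂ V V) ≤ P :=
  sup_le (Submodule.map_comap_le _ _) (Submodule.map_comap_le _ _)

theorem finrank_map_inl_sup_map_inr [FiniteDimensional ℂ V] (A B : Submodule ℂ V) :
    finrank ℂ (A.map (LinearMap.inl ℂ V V) ⊔ B.map (LinearMap.inr ℂ V V) :
      Submodule ℂ (V × V)) = finrank ℂ A + finrank ℂ B := by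
  have hd : A.map (LinearMap.inl ℂ V V) ⊓ B.map (LinearMap.inr ℂ V V) = ⊥ := by
    rw [eq_bot_iff]
    rintro ⟨a, b⟩ ⟨⟨x, _, hx⟩, ⟨y, _, hy⟩⟩
    simp only [LinearMap.inl_apply, LinearMap.inr_apply, Prod.mk.injEq] at hx hy
    simp [← hx.2, ← hy.1]
  have h := Submodule.finrank_sup_add_finrank_inf_eq (A.map (LinearMap.inl ℂ V V))
    (B.map (LinearMap.inr ℂ V V))
  rwa [hd, finrank_bot, add_zero, finrank_map_of_injective LinearMap.inl_injective,
    finrank_map_of_injective (f := LinearMap.inr ℂ V V) LinearMap.inr_injective] at h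

/-- A linear relation is generated by `rk P` of its elements together with its kernel and its
indefiniteness. -/
theorem exists_span_sup_relKer_sup_relIndef [FiniteDimensional ℂ V] (P : Submodule ℂ (V × V)) :
    ∃ p : Fin (relRk P) → V × V, P = Submodule.span ℂ (Set.range p) ⊔
      ((relKer P).map (LinearMap.inl ℂ V V) ⊔ (relIndef P).map (LinearMap.inr ℂ V V)) := by
  obtain ⟨C, hC⟩ := exists_isCompl
    ((relKer P).map (LinearMap.inl ℂ V V) ⊔ (relIndef P).map (LinearMap.inr ℂ V V))
  set K := (relKer P).map (LinearMap.inl ℂ V V) ⊔ (relIndef P).map (LinearMap.inr ℂ V V) with hK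
  have hle : K ≤ P := map_inl_sup_map_inr_le P
  have hsup : (C ⊓ P) ⊔ K = P := by
    rw [sup_comm, ← sup_inf_assoc_of_le C hle, hC.sup_eq_top, top_inf_eq]
  have hinf : (C ⊓ P) ⊓ K = ⊥ := by
    rw [eq_bot_iff, ← hC.inf_eq_bot]
    exact fun x hx => ⟨hx.2, hx.1.1⟩
  have hfin : finrank ℂ (C ⊓ P : Submodule ℂ (V × V)) = relRk P := by
    have h := Submodule.finrank_sup_add_finrank_inf_eq (C ⊓ P) K
    rw [hsup, hinf, finrank_bot, hK, finrank_map_inl_sup_map_inr] at h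
    rw [relRk]
    omega
  let b := finBasisOfFinrankEq ℂ (C ⊓ P : Submodule ℂ (V × V)) hfin
  refine ⟨fun i => b i, ?_⟩
  have hspan : Submodule.span ℂ (Set.range fun i => (b i : V × V)) = C ⊓ P := by
    have := congrArg (Submodule.map (C ⊓ P).subtype) b.span_eq
    rw [Submodule.map_span, Submodule.map_top, Submodule.range_subtype, ← Set.range_comp] at this
    exact this
  rw [hspan, hsup]

theorem relDom_eq_map_fst_sup {P S A B} (hP : P = S ⊔ (A ⊔ B))
    (hA : A = (relKer P).map (LinearMap.inl ℂ V V))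
    (hB : B = (relIndef P).map (LinearMap.inr ℂ V V)) :
    relDom P = S.map (LinearMap.fst ℂ V V) ⊔ relKer P := by
  rw [relDom]
  conv_lhs => rw [hP, Submodule.map_sup, Submodule.map_sup, hA, hB, ← Submodule.map_comp,
    ← Submodule.map_comp, LinearMap.fst_comp_inl, LinearMap.fst_comp_inr, Submodule.map_id,
    Submodule.map_zero, sup_bot_eq]

theorem relIm_eq_map_snd_sup {P S A B} (hP : P = S ⊔ (A ⊔ B))
    (hA : A = (relKer P).map (LinearMap.inl ℂ V V))
    (hB : B = (relIndef P).map (LinearMap.inr ℂ V V)) :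
    relIm P = S.map (LinearMap.snd ℂ V V) ⊔ relIndef P := by
  rw [relIm]
  conv_lhs => rw [hP, Submodule.map_sup, Submodule.map_sup, hA, hB, ← Submodule.map_comp,
    ← Submodule.map_comp, LinearMap.snd_comp_inl, LinearMap.snd_comp_inr, Submodule.map_id,
    Submodule.map_zero, bot_sup_eq]

theorem hingeAct_eq_map (g₁ g₂ : V ≃ₗ[ℂ] V) (R : Submodule ℂ (V × V)) :
    hingeAct g₁ g₂ R = R.map ((g₂.symm.prodCongr g₁ : (V × V) ≃ₗ[ℂ] V × V) :
      V × V →ₗ[ℂ] V × V) :=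
  (Submodule.map_equiv_eq_comap_symm (g₂.symm.prodCongr g₁) R).symm

theorem hingeAct_hingeAct (g₁ g₂ h₁ h₂ : V ≃ₗ[ℂ] V) (R : Submodule ℂ (V × V)) :
    hingeAct h₁ h₂ (hingeAct g₁ g₂ R) = hingeAct (g₁.trans h₁) (h₂.trans g₂) R := rfl

theorem hingeAct_symm_hingeAct (g₁ g₂ : V ≃ₗ[ℂ] V) (R : Submodule ℂ (V × V)) :
    hingeAct g₁.symm g₂.symm (hingeAct g₁ g₂ R) = R := by
  ext ⟨v, w⟩
  simp [hingeAct]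

theorem finrank_comap_equiv (g : V ≃ₗ[ℂ] V) (A : Submodule ℂ V) :
    finrank ℂ (A.comap (g : V →ₗ[ℂ] V)) = finrank ℂ A := by
  have h := Submodule.map_equiv_eq_comap_symm g.symm A
  rw [LinearEquiv.symm_symm] at h
  rw [← h, LinearEquiv.finrank_map_eq]

theorem relRk_hingeAct (g₁ g₂ : V ≃ₗ[ℂ] V) (R : Submodule ℂ (V × V)) :
    relRk (hingeAct g₁ g₂ R) = relRk R := by
  have hker : relKer (hingeAct g₁ g₂ R) = (relKer R).comap (g₂ : V →ₗ[ℂ] V) := by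
    ext v
    simp [relKer, hingeAct]
  have hindef : relIndef (hingeAct g₁ g₂ R) = (relIndef R).comap (g₁.symm : V →ₗ[ℂ] V) := by
    ext v
    simp [relIndef, hingeAct]
  rw [relRk, relRk, hker, hindef, finrank_comap_equiv, finrank_comap_equiv, hingeAct_eq_map,
    LinearEquiv.finrank_map_eq]

end Relations

section PartialSums

variable {k : ℕ} (α : Fin k → ℕ)

theorem partialSum_zero : partialSum α 0 = 0 := by
  simp [partialSum]

theorem partialSum_succ {j : ℕ} (hj : j < k) :
    partialSum α (j + 1) = partialSum α j + α ⟨j, hj⟩ := by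
  have : Finset.univ.filter (fun i : Fin k => i.1 < j + 1) =
      insert ⟨j, hj⟩ (Finset.univ.filter (fun i : Fin k => i.1 < j)) := by
    ext i
    simp only [Finset.mem_filter, Finset.mem_univ, true_and, Finset.mem_insert, Fin.ext_iff]
    omega
  rw [partialSum, partialSum, this, Finset.sum_insert (by simp), add_comm]

theorem partialSum_self : partialSum α k = ∑ i, α i := by
  simp [partialSum]

theorem partialSum_mono : Monotone (partialSum α) := fun a b hab =>
  Finset.sum_le_sum_of_subset fun i hi => by
    simp only [Finset.mem_filter, Finset.mem_univ, true_and] at hi ⊢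
    omega

theorem partialSum_add_eq (s : (i : Fin k) × Fin (α i)) :
    partialSum α s.1 + s.2 = finSigmaFinEquiv s := by
  rw [finSigmaFinEquiv_apply, partialSum]
  congr 1
  refine (Finset.sum_bij (fun i _ => Fin.castLE s.1.2.le i) ?_ ?_ ?_ ?_).symm
  · intro i _
    exact Finset.mem_filter.mpr ⟨Finset.mem_univ _, i.2⟩
  · intro a _ b _ h
    simpa [Fin.ext_iff] using h
  · intro i hi
    simp only [Finset.mem_filter, Finset.mem_univ, true_and] at hi
    exact ⟨⟨i, hi⟩, Finset.mem_univ _, rfl⟩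
  · simp

theorem lt_partialSum_iff (s : (i : Fin k) × Fin (α i)) (j : ℕ) :
    (finSigmaFinEquiv s : ℕ) < partialSum α j ↔ s.1.1 < j := by
  rw [← partialSum_add_eq]
  constructor
  · intro h
    by_contra! hj
    have := partialSum_mono α hj
    omega
  · intro h
    have := partialSum_mono α (Nat.succ_le_of_lt h)
    rw [Nat.succ_eq_add_one, partialSum_succ α s.1.2] at this
    exact (Nat.add_lt_add_left s.2.2 _).trans_le this

end PartialSums

namespace IsHinge

variable {V : Type*} [AddCommGroup V] [Module ℂ V] {k : ℕ} {P : Fin k → Submodule ℂ (V × V)}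

theorem relRk_pos (h : IsHinge P) (j : Fin k) : 0 < relRk (P j) := by
  have := h.rk_pos j
  rw [relRk]
  omega

variable [FiniteDimensional ℂ V]

theorem relRk_add (h : IsHinge P) (j : Fin k) :
    relRk (P j) + finrank ℂ (relKer (P j)) = finrank ℂ (relDom (P j)) := by
  have h₁ := h.rk_pos j
  have h₂ := finrank_relDom_add_finrank_relIndef (P j)
  rw [relRk]
  omega

theorem relIndef_first (h : IsHinge P) : relIndef (P ⟨0, h.pos⟩) = ⊥ := by
  have h₁ := finrank_relDom_add_finrank_relIndef (P ⟨0, h.pos⟩)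
  rw [h.dom_first, finrank_top, h.dim_eq] at h₁
  exact Submodule.finrank_eq_zero.mp (by omega)

theorem relKer_last (h : IsHinge P) {j : ℕ} (hj : j < k) (hjk : j + 1 = k) :
    relKer (P ⟨j, hj⟩) = ⊥ := by
  obtain rfl : j = k - 1 := by omega
  have h₁ := finrank_relIm_add_finrank_relKer (P ⟨k - 1, hj⟩)
  rw [h.im_last, finrank_top, h.dim_eq] at h₁
  exact Submodule.finrank_eq_zero.mp (by omega)

theorem partialSum_add_finrank_relDom (h : IsHinge P) (j : ℕ) (hj : j < k) :
    partialSum (fun i => relRk (P i)) j + finrank ℂ (relDom (P ⟨j, hj⟩)) = finrank ℂ V := by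
  induction j with
  | zero => rw [partialSum_zero, h.dom_first, finrank_top, zero_add]
  | succ j ih =>
    have h₁ := ih (by omega)
    rw [partialSum_succ _ (by omega : j < k), ← h.ker_eq_dom j hj]
    have h₂ := h.relRk_add ⟨j, by omega⟩
    omega

theorem sum_relRk (h : IsHinge P) : ∑ j, relRk (P j) = finrank ℂ V := by
  obtain ⟨m, rfl⟩ : ∃ m, k = m + 1 := ⟨k - 1, by have := h.pos; omega⟩
  rw [← partialSum_self, partialSum_succ _ (Nat.lt_succ_self m),
    ← h.partialSum_add_finrank_relDom m (Nat.lt_succ_self m), ← h.relRk_add,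
    h.relKer_last _ rfl, finrank_bot, add_zero]

variable {ι : Type*} {q : ι → V × V} {b : ι → ℕ}

theorem relKer_eq_span (h : IsHinge P) (hb : ∀ s, b s < k)
    (hP : ∀ j, P j = Submodule.span ℂ (q '' {s | b s = j}) ⊔
      ((relKer (P j)).map (LinearMap.inl ℂ V V) ⊔ (relIndef (P j)).map (LinearMap.inr ℂ V V)))
    (m j : ℕ) (hj : j < k) (hjm : j + m + 1 = k) :
    relKer (P ⟨j, hj⟩) = Submodule.span ℂ ((fun s => (q s).1) '' {s | j < b s}) := by
  induction m generalizing j with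
  | zero =>
    have : {s | j < b s} = ∅ := by
      refine Set.eq_empty_of_forall_notMem fun s hs => ?_
      have := hb s
      rw [Set.mem_ofPred_eq] at hs
      omega
    rw [h.relKer_last hj hjm, this, Set.image_empty, Submodule.span_empty]
  | succ m ih =>
    have : {s | j < b s} = {s | b s = j + 1} ∪ {s | j + 1 < b s} := by
      ext s
      simp only [Set.mem_ofPred_eq, Set.mem_union]
      omega
    rw [h.ker_eq_dom j (by omega), relDom_eq_map_fst_sup (hP _) rfl rfl,
      ih (j + 1) (by omega) (by omega), Submodule.map_span, ← Set.image_comp, this,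
      Set.image_union, Submodule.span_union]
    rfl

theorem relIndef_eq_span (h : IsHinge P)
    (hP : ∀ j, P j = Submodule.span ℂ (q '' {s | b s = j}) ⊔
      ((relKer (P j)).map (LinearMap.inl ℂ V V) ⊔ (relIndef (P j)).map (LinearMap.inr ℂ V V)))
    (j : ℕ) (hj : j < k) :
    relIndef (P ⟨j, hj⟩) = Submodule.span ℂ ((fun s => (q s).2) '' {s | b s < j}) := by
  induction j with
  | zero => simp [h.relIndef_first]
  | succ j ih =>
    have : {s | b s < j + 1} = {s | b s = j} ∪ {s | b s < j} := by
      ext s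
      simp only [Set.mem_ofPred_eq, Set.mem_union]
      omega
    rw [← h.im_eq_indef j hj, relIm_eq_map_snd_sup (hP _) rfl rfl, ih (by omega),
      Submodule.map_span, ← Set.image_comp, this, Set.image_union, Submodule.span_union]
    rfl

theorem span_fst_eq_top (h : IsHinge P) (hb : ∀ s, b s < k)
    (hP : ∀ j, P j = Submodule.span ℂ (q '' {s | b s = j}) ⊔
      ((relKer (P j)).map (LinearMap.inl ℂ V V) ⊔ (relIndef (P j)).map (LinearMap.inr ℂ V V))) :
    Submodule.span ℂ (Set.range fun s => (q s).1) = ⊤ := by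
  have hpos := h.pos
  rw [eq_top_iff, ← h.dom_first, relDom_eq_map_fst_sup (hP _) rfl rfl, Submodule.map_span,
    ← Set.image_comp, h.relKer_eq_span hb hP (k - 1) 0 hpos (by omega)]
  exact sup_le (Submodule.span_mono (Set.image_subset_range _ _))
    (Submodule.span_mono (Set.image_subset_range _ _))

theorem span_snd_eq_top (h : IsHinge P)
    (hP : ∀ j, P j = Submodule.span ℂ (q '' {s | b s = j}) ⊔
      ((relKer (P j)).map (LinearMap.inl ℂ V V) ⊔ (relIndef (P j)).map (LinearMap.inr ℂ V V))) :
    Submodule.span ℂ (Set.range fun s => (q s).2) = ⊤ := by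
  rw [eq_top_iff, ← h.im_last, relIm_eq_map_snd_sup (hP _) rfl rfl, Submodule.map_span,
    ← Set.image_comp, h.relIndef_eq_span hP]
  exact sup_le (Submodule.span_mono (Set.image_subset_range _ _))
    (Submodule.span_mono (Set.image_subset_range _ _))

end IsHinge

/-- The image of a canonical relation under the action of `GL(V) × GL(V)`, in terms of the bases
`g₂⁻¹ e_i` and `g₁ e_i`. -/
theorem hingeAct_canonicalRel {n : ℕ} (a c : ℕ) {q : Fin n → (Fin n → ℂ) × (Fin n → ℂ)}
    {g₁ g₂ : (Fin n → ℂ) ≃ₗ[ℂ] (Fin n → ℂ)}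
    (hg₁ : ∀ i, g₁ (Pi.basisFun ℂ (Fin n) i) = (q i).2)
    (hg₂ : ∀ i, g₂.symm (Pi.basisFun ℂ (Fin n) i) = (q i).1) :
    hingeAct g₁ g₂ (canonicalRel n a c) =
      Submodule.span ℂ (q '' {s | a ≤ s.1 ∧ s.1 < c}) ⊔
        ((Submodule.span ℂ ((fun s => (q s).1) '' {s | c ≤ s.1})).map (LinearMap.inl ℂ _ _) ⊔
          (Submodule.span ℂ ((fun s => (q s).2) '' {s | s.1 < a})).map (LinearMap.inr ℂ _ _)) := by
  rw [hingeAct_eq_map, canonicalRel, Submodule.map_span, Submodule.map_span, Submodule.map_span,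
    ← Submodule.span_union, ← Submodule.span_union]
  congr 1
  ext x
  constructor
  · rintro ⟨_, ⟨σ, ⟨h, rfl⟩ | ⟨h, h', rfl⟩ | ⟨h, rfl⟩⟩, rfl⟩
    · exact Or.inr (Or.inr ⟨_, ⟨σ, h, rfl⟩, Prod.ext (map_zero g₂.symm).symm (hg₁ σ).symm⟩)
    · exact Or.inl ⟨σ, ⟨h, h'⟩, Prod.ext (hg₂ σ).symm (hg₁ σ).symm⟩
    · exact Or.inr (Or.inl ⟨_, ⟨σ, h, rfl⟩, Prod.ext (hg₂ σ).symm (map_zero g₁).symm⟩)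
  · rintro (⟨σ, ⟨h, h'⟩, rfl⟩ | ⟨_, ⟨σ, h, rfl⟩, rfl⟩ | ⟨_, ⟨σ, h, rfl⟩, rfl⟩)
    · exact ⟨_, ⟨σ, Or.inr (Or.inl ⟨h, h', rfl⟩)⟩, Prod.ext (hg₂ σ) (hg₁ σ)⟩
    · exact ⟨_, ⟨σ, Or.inr (Or.inr ⟨h, rfl⟩)⟩, Prod.ext (hg₂ σ) (map_zero g₁)⟩
    · exact ⟨_, ⟨σ, Or.inl ⟨h, rfl⟩⟩, Prod.ext (map_zero g₂.symm) (hg₁ σ)⟩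

theorem exists_basis_of_span_eq_top {n : ℕ} {v : Fin n → Fin n → ℂ}
    (hv : Submodule.span ℂ (Set.range v) = ⊤) :
    ∃ b : Basis (Fin n) ℂ (Fin n → ℂ), ∀ i, b i = v i :=
  ⟨basisOfTopLeSpanOfCardEqFinrank v hv.ge (by simp), fun i => by simp⟩

/-- Every hinge is equivalent to the canonical hinge given by its sequence of ranks. -/
theorem IsHinge.exists_eq_hingeAct_canonicalHinge {n k : ℕ}
    {P : Fin k → Submodule ℂ ((Fin n → ℂ) × (Fin n → ℂ))} (h : IsHinge P) :
    ∃ g₁ g₂ : (Fin n → ℂ) ≃ₗ[ℂ] (Fin n → ℂ),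
      ∀ j, P j = hingeAct g₁ g₂ (canonicalHinge n (fun i => relRk (P i)) j) := by
  choose p hp using fun j => exists_span_sup_relKer_sup_relIndef (P j)
  have hsum : ∑ j, relRk (P j) = n := by simpa using h.sum_relRk
  let e : ((j : Fin k) × Fin (relRk (P j))) ≃ Fin n := finSigmaFinEquiv.trans (finCongr hsum)
  let q : Fin n → (Fin n → ℂ) × (Fin n → ℂ) := fun s => p (e.symm s).1 (e.symm s).2
  let b : Fin n → ℕ := fun s => (e.symm s).1
  have hb : ∀ s, b s < k := fun s => (e.symm s).1.2
  have hbiff : ∀ s j, s.1 < partialSum (fun i => relRk (P i)) j ↔ b s < j := by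
    intro s j
    obtain ⟨t, rfl⟩ := e.surjective s
    simp only [b, Equiv.symm_apply_apply]
    exact lt_partialSum_iff (fun i => relRk (P i)) t j
  have hrange : ∀ j : Fin k, q '' {s | b s = j} = Set.range (p j) := by
    intro j
    ext x
    constructor
    · rintro ⟨s, hs, rfl⟩
      obtain rfl : (e.symm s).1 = j := Fin.ext hs
      exact ⟨_, rfl⟩
    · rintro ⟨t, rfl⟩
      exact ⟨e ⟨j, t⟩, by simp [b], by simp only [q]; rw [e.symm_apply_apply]⟩
  have hP : ∀ j, P j = Submodule.span ℂ (q '' {s | b s = j}) ⊔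
      ((relKer (P j)).map (LinearMap.inl ℂ _ _) ⊔
        (relIndef (P j)).map (LinearMap.inr ℂ _ _)) := by
    intro j
    rw [hrange]
    exact hp j
  obtain ⟨v, hv⟩ := exists_basis_of_span_eq_top (h.span_fst_eq_top hb hP)
  obtain ⟨w, hw⟩ := exists_basis_of_span_eq_top (h.span_snd_eq_top hP)
  refine ⟨(Pi.basisFun ℂ (Fin n)).equiv w (Equiv.refl _),
    v.equiv (Pi.basisFun ℂ (Fin n)) (Equiv.refl _), fun j => ?_⟩
  rw [canonicalHinge, hingeAct_canonicalRel (q := q) _ _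
    (fun i => (Basis.equiv_apply _ _ _ _).trans (hw i))
    (fun i => by rw [Basis.equiv_symm, Basis.equiv_apply]; exact hv i)]
  have hset : {s : Fin n | partialSum (fun i => relRk (P i)) j ≤ s.1 ∧
      s.1 < partialSum (fun i => relRk (P i)) (j + 1)} = {s | b s = j} := by
    ext s
    simp only [Set.mem_ofPred_eq, hbiff, ← not_lt]
    omega
  have hset' : {s : Fin n | partialSum (fun i => relRk (P i)) (j + 1) ≤ s.1} =
      {s | j.1 < b s} := by
    ext s
    simp only [Set.mem_ofPred_eq, hbiff, ← not_lt]
    omega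
  rw [hset, hset']
  simp only [hbiff]
  rw [← h.relKer_eq_span hb hP (k - 1 - j) j j.2 (by omega), ← h.relIndef_eq_span hP j j.2]
  exact hP j

theorem hinge_orbit_classification (n k : ℕ)
    (P : Fin k → Submodule ℂ ((Fin n → ℂ) × (Fin n → ℂ))) (h : IsHinge P) :
    ((∀ j, 0 < relRk (P j)) ∧ ∑ j, relRk (P j) = n) ∧
    (∃ g₁ g₂ : (Fin n → ℂ) ≃ₗ[ℂ] (Fin n → ℂ),
      ∀ j, P j = hingeAct g₁ g₂ (canonicalHinge n (fun i => relRk (P i)) j)) ∧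
    (∀ P' : Fin k → Submodule ℂ ((Fin n → ℂ) × (Fin n → ℂ)), IsHinge P' →
      ((∃ g₁ g₂ : (Fin n → ℂ) ≃ₗ[ℂ] (Fin n → ℂ), ∀ j, P' j = hingeAct g₁ g₂ (P j)) ↔
        ∀ j, relRk (P' j) = relRk (P j))) := by
  refine ⟨⟨h.relRk_pos, by simpa using h.sum_relRk⟩, h.exists_eq_hingeAct_canonicalHinge, ?_⟩
  intro P' h'
  constructor
  · rintro ⟨g₁, g₂, hg⟩ j
    rw [hg, relRk_hingeAct]
  · intro hrk
    obtain ⟨g₁, g₂, hg⟩ := h.exists_eq_hingeAct_canonicalHinge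
    obtain ⟨f₁, f₂, hf⟩ := h'.exists_eq_hingeAct_canonicalHinge
    refine ⟨g₁.symm.trans f₁, f₂.trans g₂.symm, fun j => ?_⟩
    rw [← hingeAct_hingeAct, hg j, hingeAct_symm_hingeAct, hf j]
    simp only [hrk]

end
end
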